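/- arXiv:math/0307182 — 3 statements merged into one kernel-verified Lean document; each statement's English description precedes it below -/
import Mathlib

section
/- Let $p$ be a prime and $k$ a field. Let $V$ be the $k$-vector space with basis the monomials $x^a = x_1^{a_1}\cdots x_p^{a_p}$ in $k[x_1,\dots,x_p]$ with $a \ne 0$ and $\min_i a_i = 0$, regarded as a representation of the cyclic group $C_p$ acting by cyclic permutation of the variables. Then the group cohomology $H^n(C_p; V)$ vanishes for all $n \ge 1$. -/
open CategoryTheory

universe u

namespace Representation

variable {k G V : Type*} [CommRing k] [Group G] [Fintype G] [AddCommGroup V] [Module k V]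
  (ρ : Representation k G V) (T : V →ₗ[k] V)

/-- If the identity is a trace `∑ g, ρ g ∘ T ∘ ρ g⁻¹`, every invariant vector is a norm. -/
lemma mem_range_norm_of_sum_conj_eq (hT : ∀ x, ∑ g, ρ g (T (ρ g⁻¹ x)) = x) {x : V}
    (hx : ∀ g, ρ g x = x) : x ∈ LinearMap.range ρ.norm := by
  refine ⟨T x, ?_⟩
  simpa [norm, hx] using hT x

/-- If the identity is a trace `∑ g, ρ g ∘ T ∘ ρ g⁻¹`, every vector of norm zero dies in the
coinvariants. -/
lemma mem_coinvariantsKer_of_sum_conj_eq (hT : ∀ x, ∑ g, ρ g (T (ρ g⁻¹ x)) = x) {x : V}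
    (hx : ρ.norm x = 0) : x ∈ Coinvariants.ker ρ := by
  have h : ∑ g, T (ρ g⁻¹ x) = 0 := by
    rw [← map_sum, Fintype.sum_equiv (Equiv.inv G) (fun g => ρ g⁻¹ x)
      (fun g => ρ g x) (fun _ => rfl)]
    have hx' : ∑ g, ρ g x = 0 := by simpa [norm] using hx
    rw [hx', map_zero]
  have hsub : x = ∑ g, (ρ g (T (ρ g⁻¹ x)) - T (ρ g⁻¹ x)) := by
    rw [Finset.sum_sub_distrib, h, sub_zero, hT]
  rw [hsub]
  exact Submodule.sum_mem _ fun g _ => Coinvariants.sub_mem_ker g _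

end Representation

/-- Over a finite cyclic group, a representation whose identity is a trace has no cohomology in
positive degrees. -/
lemma Rep.FiniteCyclicGroup.isZero_groupCohomology_of_sum_conj_eq {k G : Type u} [CommRing k]
    [CommGroup G] [Fintype G] (A : Rep.{u} k G) (g : G) (hg : ∀ x, x ∈ Subgroup.zpowers g)
    (T : A →ₗ[k] A) (hT : ∀ x, ∑ g, A.ρ g (T (A.ρ g⁻¹ x)) = x) (n : ℕ) (hn : 1 ≤ n) :
    Limits.IsZero (groupCohomology A n) := by
  rcases Nat.even_or_odd n with h | h
  · have : NeZero n := ⟨by lia⟩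
    refine Limits.IsZero.of_iso ?_ (groupCohomologyIsoEven A g hg n h)
    rw [← ShortComplex.exact_iff_isZero_homology, ShortComplex.moduleCat_exact_iff]
    intro x hx
    have hx' : A.ρ g x = x := by simpa [sub_hom, sub_eq_zero] using hx
    exact A.ρ.mem_range_norm_of_sum_conj_eq T hT
      ((Representation.mem_invariants_iff_of_forall_mem_zpowers A.ρ g hg x).2 hx')
  · refine Limits.IsZero.of_iso ?_ (groupCohomologyIsoOdd A g hg n h)
    rw [← ShortComplex.exact_iff_isZero_homology, ShortComplex.moduleCat_exact_iff]
    intro x hx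
    have hmem := A.ρ.mem_coinvariantsKer_of_sum_conj_eq T hT hx
    rw [Representation.FiniteCyclicGroup.coinvariantsKer_eq_range A.ρ g hg] at hmem
    obtain ⟨y, hy⟩ := hmem
    exact ⟨y, by simpa [sub_hom] using hy⟩

namespace Finsupp

/-- Translation of exponent vectors by elements of the index group. -/
noncomputable def mapTranslate {G : Type*} [AddGroup G] (g : G) (a : G →₀ ℕ) : G →₀ ℕ :=
  a.mapDomain (g + ·)

section AddGroup

variable {G : Type*} [AddGroup G]

lemma mapTranslate_mapTranslate (g h : G) (a : G →₀ ℕ) :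
    mapTranslate g (mapTranslate h a) = mapTranslate (g + h) a := by
  simp only [mapTranslate, ← mapDomain_comp]
  congr 1
  ext x
  simp [add_assoc]

lemma mapTranslate_zero (a : G →₀ ℕ) : mapTranslate 0 a = a := by
  simp only [mapTranslate, zero_add]
  exact mapDomain_id

lemma mapTranslate_apply_add (g : G) (a : G →₀ ℕ) (i : G) : mapTranslate g a (g + i) = a i :=
  mapDomain_apply (add_right_injective g) a i

/-- The orbit relation of translation on exponent vectors. -/
def translateSetoid (G : Type*) [AddGroup G] : Setoid (G →₀ ℕ) where
  r a b := ∃ g, mapTranslate g a = b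
  iseqv :=
    { refl := fun a => ⟨0, mapTranslate_zero a⟩
      symm := by
        rintro a _ ⟨g, rfl⟩
        exact ⟨-g, by rw [mapTranslate_mapTranslate, neg_add_cancel, mapTranslate_zero]⟩
      trans := by
        rintro a _ _ ⟨g, rfl⟩ ⟨h, rfl⟩
        exact ⟨h + g, (mapTranslate_mapTranslate _ _ _).symm⟩ }

/-- A set of representatives of the orbits of translation on exponent vectors. -/
def translateReps (G : Type*) [AddGroup G] : Set (G →₀ ℕ) :=
  {a | (Quotient.mk (translateSetoid G) a).out = a}

lemma exists_mapTranslate_mem_translateReps (a : G →₀ ℕ) :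
    ∃ g, mapTranslate g a ∈ translateReps G := by
  let _ := translateSetoid G
  obtain ⟨g, hg⟩ := Setoid.symm (Quotient.mk_out a)
  refine ⟨g, ?_⟩
  have h : Quotient.mk (translateSetoid G) (mapTranslate g a) = Quotient.mk (translateSetoid G) a :=
    Quotient.sound (Setoid.symm ⟨g, rfl⟩)
  rw [translateReps, Set.mem_ofPred_eq, h]
  exact hg.symm

lemma mapTranslate_eq_of_mem_translateReps {a : G →₀ ℕ} {g h : G}
    (hg : mapTranslate g a ∈ translateReps G) (hh : mapTranslate h a ∈ translateReps G) :
    mapTranslate g a = mapTranslate h a := by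
  have key : Quotient.mk (translateSetoid G) (mapTranslate g a) =
      Quotient.mk (translateSetoid G) (mapTranslate h a) :=
    Quotient.sound ⟨h - g, by rw [mapTranslate_mapTranslate, sub_add_cancel]⟩
  rw [← hg, ← hh, key]

end AddGroup

/-- For `p` prime, only constant exponent vectors have a nontrivial stabilizer in `ℤ/p`. -/
lemma eq_zero_of_mapTranslate_eq_self {p : ℕ} [Fact p.Prime] {a : ZMod p →₀ ℕ} {i : ZMod p}
    (hi : a i = 0) {g : ZMod p} (hg : g ≠ 0) (h : mapTranslate g a = a) : a = 0 := by
  have step (j : ZMod p) : a (g + j) = a j := by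
    conv_lhs => rw [← h]
    exact mapTranslate_apply_add g a j
  have mul (m : ℕ) : a (m * g + i) = 0 := by
    induction m with
    | zero => simpa using hi
    | succ m ih => rw [← ih, ← step (m * g + i)]; congr 1; push_cast; ring
  ext j
  have := mul ((j - i) / g).val
  rwa [ZMod.natCast_zmod_val, div_mul_cancel₀ _ hg, sub_add_cancel] at this

lemma existsUnique_mapTranslate_mem_translateReps {p : ℕ} [Fact p.Prime] {a : ZMod p →₀ ℕ}
    (ha : a ≠ 0) {i : ZMod p} (hi : a i = 0) :
    ∃! g, mapTranslate g a ∈ translateReps (ZMod p) := by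
  obtain ⟨g, hg⟩ := exists_mapTranslate_mem_translateReps a
  refine ⟨g, hg, fun h hh => ?_⟩
  by_contra hne
  have heq := congrArg (mapTranslate (-g)) (mapTranslate_eq_of_mem_translateReps hh hg)
  rw [mapTranslate_mapTranslate, mapTranslate_mapTranslate, neg_add_cancel, mapTranslate_zero] at heq
  exact ha (eq_zero_of_mapTranslate_eq_self hi (fun h0 => hne (neg_add_eq_zero.1 h0).symm) heq)

end Finsupp

open Finsupp in
open scoped Classical in
/-- The projection of a polynomial ring onto the span of the monomials whose exponents are the
chosen representatives of the translation orbits. -/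
noncomputable def MvPolynomial.translateRepsProj (k G : Type*) [CommRing k] [AddGroup G] :
    MvPolynomial G k →ₗ[k] MvPolynomial G k :=
  (MvPolynomial.basisMonomials G k).constr k
    fun a => if a ∈ translateReps G then MvPolynomial.monomial a 1 else 0

open Finsupp in
open scoped Classical in
lemma MvPolynomial.translateRepsProj_monomial {k G : Type*} [CommRing k] [AddGroup G]
    (a : G →₀ ℕ) : translateRepsProj k G (monomial a 1) =
      if a ∈ translateReps G then monomial a 1 else 0 := by
  simpa [translateRepsProj] using (basisMonomials G k).constr_basis k
    (fun a => if a ∈ translateReps G then monomial a (1 : k) else 0) a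

lemma MvPolynomial.rename_add_left_monomial {R G : Type*} [CommSemiring R] [AddGroup G] (g : G)
    (a : G →₀ ℕ) (r : R) :
    rename (g + ·) (monomial a r) = monomial (Finsupp.mapTranslate g a) r :=
  rename_monomial _ _ _

open Finsupp in
lemma MvPolynomial.sum_rename_translateRepsProj {k : Type*} [CommRing k] {p : ℕ} [Fact p.Prime]
    {a : ZMod p →₀ ℕ} (ha : a ≠ 0) {i : ZMod p} (hi : a i = 0) :
    ∑ g : ZMod p, rename (g + ·) (translateRepsProj k (ZMod p) (rename (-g + ·) (monomial a 1))) =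
      monomial a 1 := by
  classical
  obtain ⟨g, hg, huniq⟩ := existsUnique_mapTranslate_mem_translateReps ha hi
  have term (h : ZMod p) :
      rename (h + ·) (translateRepsProj k (ZMod p) (rename (-h + ·) (monomial a 1))) =
        if h = -g then monomial a 1 else 0 := by
    have hiff : mapTranslate (-h) a ∈ translateReps (ZMod p) ↔ h = -g :=
      ⟨fun hh => by rw [← huniq _ hh, neg_neg], by rintro rfl; rwa [neg_neg]⟩
    rw [rename_add_left_monomial, translateRepsProj_monomial, if_congr hiff rfl rfl]
    split_ifs
    · rw [rename_add_left_monomial, mapTranslate_mapTranslate, add_neg_cancel, mapTranslate_zero]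
    · exact map_zero _
  simp [term]

/-- Let `p` be a prime and `k` a field.  Let `V` be the `k`-subspace of
`k[x₁,…,x_p]` (variables indexed by `ℤ/p`) spanned by the monomials `x^a` with `a ≠ 0` and
`min_i a_i = 0`, regarded via `ρ` as a representation of the cyclic group `C_p = ℤ/p`
acting by cyclic permutation of the variables.  Then the group cohomology
`H^n(C_p; V)` vanishes for all `n ≥ 1`. -/
theorem stmt_6 (p : ℕ) (hp : p.Prime) (k : Type) [Field k]
    (V : Submodule k (MvPolynomial (ZMod p) k))
    (hV : V = Submodule.span k {m | ∃ a : ZMod p →₀ ℕ, a ≠ 0 ∧ (∃ i, a i = 0) ∧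
      m = MvPolynomial.monomial a 1})
    (ρ : Representation k (Multiplicative (ZMod p)) V)
    (hρ : ∀ (g : Multiplicative (ZMod p)) (x : V),
      ((ρ g x : V) : MvPolynomial (ZMod p) k)
        = MvPolynomial.rename (fun i => Multiplicative.toAdd g + i)
            (x : MvPolynomial (ZMod p) k)) :
    ∀ n : ℕ, 1 ≤ n → Limits.IsZero (groupCohomology (Rep.of ρ) n) := by
  have : Fact p.Prime := ⟨hp⟩
  have hmaps : ∀ x ∈ V, MvPolynomial.translateRepsProj k (ZMod p) x ∈ V := by
    intro x hx
    rw [hV] at hx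
    induction hx using Submodule.span_induction with
    | mem x hx =>
      obtain ⟨a, ha, hi, rfl⟩ := hx
      rw [MvPolynomial.translateRepsProj_monomial]
      split_ifs
      · rw [hV]
        exact Submodule.subset_span ⟨a, ha, hi, rfl⟩
      · exact V.zero_mem
    | zero => simp
    | add x y _ _ hx hy => rw [map_add]; exact V.add_mem hx hy
    | smul c x _ hx => rw [map_smul]; exact V.smul_mem c hx
  have hsum : ∀ x ∈ V, ∑ g : ZMod p, MvPolynomial.rename (g + ·)
      (MvPolynomial.translateRepsProj k (ZMod p) (MvPolynomial.rename (-g + ·) x)) = x := by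
    intro x hx
    rw [hV] at hx
    induction hx using Submodule.span_induction with
    | mem x hx =>
      obtain ⟨a, ha, ⟨i, hi⟩, rfl⟩ := hx
      exact MvPolynomial.sum_rename_translateRepsProj ha hi
    | zero => simp
    | add x y _ _ hx hy => simp only [map_add, Finset.sum_add_distrib, hx, hy]
    | smul c x _ hx => simp only [map_smul, ← Finset.smul_sum, hx]
  refine Rep.FiniteCyclicGroup.isZero_groupCohomology_of_sum_conj_eq (Rep.of ρ)
    (Multiplicative.ofAdd 1) (fun x => ⟨(x.toAdd.val : ℤ), ?_⟩)
    ((MvPolynomial.translateRepsProj k (ZMod p)).restrict hmaps) fun x => ?_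
  · apply Multiplicative.toAdd.injective
    simp
  · apply Subtype.ext
    refine Eq.trans ?_ (hsum x x.2)
    change ((∑ g, ρ g (_ : V) : V) : MvPolynomial (ZMod p) k) = _
    rw [AddSubmonoidClass.coe_finsetSum]
    refine Fintype.sum_equiv Multiplicative.toAdd _ _ fun g => ?_
    rw [hρ, LinearMap.coe_restrict_apply]
    exact congrArg (fun y => MvPolynomial.rename _ (MvPolynomial.translateRepsProj k (ZMod p) y))
      (hρ g⁻¹ x)
end

section
/- Let $p$ be a prime. Let $V$ be the $\mathbb{F}_p$-vector space with basis the monomials $x^a = x_1^{a_1}\cdots x_p^{a_p}$ in $\mathbb{F}_p[x_1,\dots,x_p]$ with $a \ne 0$ and $\min_i a_i = 0$, regarded as a representation of the symmetric group $\Sigma_p$ acting by permutation of the variables. Then the group cohomology $H^n(\Sigma_p; V)$ vanishes for all $n \ge 1$, and $H^0(\Sigma_p; V) = V^{\Sigma_p}$ is the subspace of $\Sigma_p$-invariants. -/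
open CategoryTheory

/-- There is a function on a `G`-set whose sum over `G` along the orbit of `x` is `1` whenever the
order of the stabilizer of `x` is invertible. -/
theorem exists_sum_smul_eq_one (G X k : Type*) [Group G] [Fintype G] [MulAction G X] [Field k] :
    ∃ w : X → k, ∀ x, (Nat.card (MulAction.stabilizer G x) : k) ≠ 0 → ∑ g : G, w (g • x) = 1 := by
  classical
  let rep : X → X := fun x ↦ (Quotient.mk (MulAction.orbitRel G X) x).out
  have rep_smul (g : G) (x : X) : rep (g • x) = rep x := by
    refine congrArg Quotient.out (Quotient.sound ?_)
    exact ⟨g, rfl⟩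
  refine ⟨fun x ↦ if x = rep x then (Nat.card (MulAction.stabilizer G x) : k)⁻¹ else 0,
    fun x hx ↦ ?_⟩
  obtain ⟨h, hh⟩ : ∃ h : G, h • x = rep x :=
    Quotient.exact (Quotient.out_eq (Quotient.mk (MulAction.orbitRel G X) x))
  have hcard : Nat.card (MulAction.stabilizer G (rep x)) = Nat.card (MulAction.stabilizer G x) :=
    Nat.card_congr (MulAction.stabilizerEquivStabilizerOfOrbitRel ⟨h, hh⟩).toEquiv
  rw [← Equiv.sum_comp (Equiv.mulRight h)]
  simp only [Equiv.coe_mulRight, mul_smul, hh, rep_smul]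
  have hrep : rep (rep x) = rep x := by rw [← hh, rep_smul, hh]
  have (g : G) : (if g • rep x = rep (rep x) then
      (Nat.card (MulAction.stabilizer G (g • rep x)) : k)⁻¹ else 0) =
      if g ∈ MulAction.stabilizer G (rep x) then
        (Nat.card (MulAction.stabilizer G x) : k)⁻¹ else 0 := by
    rw [hrep]
    by_cases hg : g • rep x = rep x
    · rw [if_pos hg, if_pos (MulAction.mem_stabilizer_iff.2 hg), hg, hcard]
    · rw [if_neg hg, if_neg (mt MulAction.mem_stabilizer_iff.1 hg)]
  rw [Finset.sum_congr rfl fun g _ ↦ this g, ← Finset.sum_filter, Finset.sum_const,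
    ← Fintype.card_subtype, nsmul_eq_mul]
  have : Fintype.card {g // g ∈ MulAction.stabilizer G (rep x)} =
    Nat.card (MulAction.stabilizer G x) := by rw [← hcard, Nat.card_eq_fintype_card]
  rw [this, mul_inv_cancel₀ hx]

/-- A group of permutations of a set of prime cardinality `p` preserving a nonconstant function has
order prime to `p`. -/
theorem not_dvd_card_of_forall_apply_eq {α β : Type*} [Fintype α]
    (hα : (Fintype.card α).Prime) (f : α → β) {i j : α} (hij : f i ≠ f j)
    (H : Subgroup (Equiv.Perm α)) (hH : ∀ g ∈ H, ∀ x, f (g x) = f x) :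
    ¬ Fintype.card α ∣ Nat.card H := by
  classical
  intro hdvd
  have : Fact (Fintype.card α).Prime := ⟨hα⟩
  obtain ⟨⟨σ, hσ⟩, hord⟩ := exists_prime_orderOf_dvd_card' _ hdvd
  rw [Subgroup.orderOf_mk] at hord
  have hcyc := Equiv.Perm.isCycle_of_prime_order'' hα hord
  have hsupp : σ.support = Finset.univ := by
    rw [← Finset.card_eq_iff_eq_univ, ← hcyc.orderOf, hord]
  obtain ⟨n, hn⟩ := hcyc.exists_zpow_eq (x := i) (y := j)
    (Equiv.Perm.mem_support.1 (hsupp ▸ Finset.mem_univ _))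
    (Equiv.Perm.mem_support.1 (hsupp ▸ Finset.mem_univ _))
  exact hij (by rw [← hn, hH _ (H.zpow_mem hσ n)])

theorem Fin.contractNth_zero_cons {n : ℕ} {α : Type*} (op : α → α → α) (a : α)
    (t : Fin (n + 1) → α) :
    Fin.contractNth (0 : Fin (n + 2)) op (Fin.cons a t : Fin (n + 2) → α) =
      Fin.cons (op a (t 0)) fun i ↦ t i.succ := by
  funext i
  cases i using Fin.cases with
  | zero => simp [Fin.contractNth]
  | succ i => simp [Fin.contractNth]

theorem Fin.contractNth_succ_cons {n : ℕ} {α : Type*} (op : α → α → α) (a : α)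
    (t : Fin (n + 1) → α) (j : Fin (n + 1)) :
    Fin.contractNth j.succ op (Fin.cons a t : Fin (n + 2) → α) =
      Fin.cons a (Fin.contractNth j op t) := by
  funext i
  cases i using Fin.cases with
  | zero => simp [Fin.contractNth]
  | succ i => simp [Fin.contractNth]

/-- If the identity of `A` is the sum of the `G`-conjugates of a linear endomorphism, then the
positive-degree cohomology of `A` vanishes. -/
theorem isZero_groupCohomology_succ_of_sum_eq.{u} {k G : Type u} [CommRing k] [Group G] [Fintype G]
    (A : Rep.{u} k G) (e : A →ₗ[k] A) (he : ∀ x, ∑ g : G, A.ρ g (e (A.ρ g⁻¹ x)) = x) (n : ℕ) :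
    Limits.IsZero (groupCohomology A (n + 1)) := by
  refine HomologicalComplex.ExactAt.isZero_homology ?_
  rw [HomologicalComplex.exactAt_iff' _ n (n + 1) (n + 2) (by simp) (by simp),
    ShortComplex.moduleCat_exact_iff]
  intro f hf
  change (Fin (n + 1) → G) → A at f
  change (groupCohomology.inhomogeneousCochains A).d (n + 1) (n + 2) f = 0 at hf
  rw [groupCohomology.inhomogeneousCochains.d_def] at hf
  suffices ∃ h : (Fin n → G) → A, inhomogeneousCochains.d A n h = f by
    obtain ⟨h, hh⟩ := this
    refine ⟨h, ?_⟩
    change (groupCohomology.inhomogeneousCochains A).d n (n + 1) h = f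
    rw [groupCohomology.inhomogeneousCochains.d_def, hh]
  refine ⟨fun t ↦ ∑ g : G, A.ρ g (e (f (Fin.cons g⁻¹ t))), ?_⟩
  funext t
  have key (g : G) : A.ρ g (e (A.ρ g⁻¹ (f t))) =
      A.ρ g (e (f (Fin.cons (g⁻¹ * t 0) fun i ↦ t i.succ))) +
      ∑ j : Fin (n + 1), (-1 : k) ^ ((j : ℕ) + 1) •
        A.ρ g (e (f (Fin.cons g⁻¹ (Fin.contractNth j (· * ·) t)))) := by
    have h := congrFun hf (Fin.cons g⁻¹ t)
    rw [inhomogeneousCochains.d_hom_apply, Fin.sum_univ_succ, Fin.contractNth_zero_cons] at h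
    simp only [Fin.contractNth_succ_cons, Fin.cons_zero, Fin.cons_succ, Fin.val_zero, Fin.val_succ,
      pow_succ _ (_ + 1), mul_neg_one, neg_smul, Finset.sum_neg_distrib, zero_add, pow_one,
      one_smul] at h
    change A.ρ g⁻¹ (f t) + _ = 0 at h
    rw [← neg_add, ← sub_eq_add_neg, sub_eq_zero] at h
    simp [h]
  rw [inhomogeneousCochains.d_hom_apply, ← he (f t), Finset.sum_congr rfl fun g _ ↦ key g,
    Finset.sum_add_distrib, Finset.sum_comm, map_sum]
  congr 1
  · rw [← Equiv.sum_comp (Equiv.mulLeft (t 0)) fun g ↦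
      A.ρ g (e (f (Fin.cons (g⁻¹ * t 0) fun i ↦ t i.succ)))]
    simp
  · simp only [Finset.smul_sum]

open MvPolynomial in
/-- The identity of the span of the monomials `x^a` with `a ≠ 0` and `min_i a_i = 0` is the sum of
the `Σ_p`-conjugates of a linear endomorphism. -/
theorem exists_sum_conj_eq_self (p : ℕ) (hp : p.Prime)
    (V : Submodule (ZMod p) (MvPolynomial (Fin p) (ZMod p)))
    (hV : V = Submodule.span (ZMod p) {m | ∃ a : Fin p →₀ ℕ, a ≠ 0 ∧ (∃ i, a i = 0) ∧
      m = MvPolynomial.monomial a 1})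
    (ρ : Representation (ZMod p) (Equiv.Perm (Fin p)) V)
    (hρ : ∀ (g : Equiv.Perm (Fin p)) (x : V),
      ((ρ g x : V) : MvPolynomial (Fin p) (ZMod p))
        = MvPolynomial.rename (⇑g) (x : MvPolynomial (Fin p) (ZMod p))) :
    ∃ e : V →ₗ[ZMod p] V, ∀ x, ∑ g, ρ g (e (ρ g⁻¹ x)) = x := by
  have : Fact p.Prime := ⟨hp⟩
  let _ : MulAction (Equiv.Perm (Fin p)) (Fin p →₀ ℕ) := Finsupp.comapMulAction
  have smul_def (g : Equiv.Perm (Fin p)) (a : Fin p →₀ ℕ) : g • a = a.mapDomain g := rfl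
  obtain ⟨w, hw⟩ := exists_sum_smul_eq_one (Equiv.Perm (Fin p)) (Fin p →₀ ℕ) (ZMod p)
  have hw' (a : Fin p →₀ ℕ) (ha : a ≠ 0) (ha' : ∃ i, a i = 0) :
      ∑ g : Equiv.Perm (Fin p), w (g • a) = 1 := by
    refine hw a fun h ↦ ?_
    obtain ⟨i, hi⟩ := ha'
    obtain ⟨j, hj⟩ := Finsupp.ne_iff.1 ha
    rw [ZMod.natCast_eq_zero_iff] at h
    refine not_dvd_card_of_forall_apply_eq (by simpa using hp) a (i := i) (j := j)
      (by rw [hi]; exact hj.symm) (MulAction.stabilizer (Equiv.Perm (Fin p)) a) (fun g hg x ↦ ?_)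
      (by simpa using h)
    rw [MulAction.mem_stabilizer_iff, smul_def] at hg
    conv_lhs => rw [← hg]
    exact Finsupp.mapDomain_apply g.injective _ _
  let E : MvPolynomial (Fin p) (ZMod p) →ₗ[ZMod p] MvPolynomial (Fin p) (ZMod p) :=
    (basisMonomials (Fin p) (ZMod p)).constr (ZMod p) fun a ↦ w a • monomial a 1
  have hE (a : Fin p →₀ ℕ) : E (monomial a 1) = w a • monomial a 1 := by
    simpa using (basisMonomials (Fin p) (ZMod p)).constr_basis (ZMod p)
      (fun a ↦ w a • monomial a 1) a
  have hEV : ∀ x ∈ V, E x ∈ V := by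
    suffices V ≤ V.comap E from this
    conv_lhs => rw [hV]
    rw [Submodule.span_le]
    rintro _ ⟨a, ha, ha', rfl⟩
    rw [SetLike.mem_coe, Submodule.mem_comap, hE, hV]
    exact Submodule.smul_mem _ _ (Submodule.subset_span ⟨a, ha, ha', rfl⟩)
  refine ⟨E.restrict hEV, fun ⟨x, hx⟩ ↦ Subtype.ext ?_⟩
  simp only [AddSubmonoidClass.coe_finsetSum, hρ, LinearMap.coe_restrict_apply]
  rw [hV] at hx
  induction hx using Submodule.span_induction with
  | mem x h =>
    obtain ⟨a, ha, ha', rfl⟩ := h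
    have (g : Equiv.Perm (Fin p)) : rename g (E (rename ⇑g⁻¹ (monomial a 1))) =
        w (g⁻¹ • a) • monomial a 1 := by
      rw [rename_monomial, hE, map_smul, rename_monomial, ← smul_def, ← smul_def, smul_inv_smul]
    rw [Finset.sum_congr rfl fun g _ ↦ this g, ← Finset.sum_smul,
      Fintype.sum_equiv (Equiv.inv _) (fun g ↦ w (g⁻¹ • a)) (fun g ↦ w (g • a)) fun _ ↦ rfl,
      hw' a ha ha', one_smul]
  | zero => simp
  | add x y _ _ hx hy => simp only [map_add, Finset.sum_add_distrib, hx, hy]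
  | smul c x _ hx => simp only [map_smul, ← Finset.smul_sum, hx]

/-- Let `p` be a prime.  Let `V` be the `𝔽_p`-subspace of
`𝔽_p[x₁,…,x_p]` spanned by the monomials `x^a` with `a ≠ 0` and `min_i a_i = 0`, regarded
via `ρ` as a representation of the symmetric group `Σ_p` permuting the variables.  Then
`H^n(Σ_p; V) = 0` for all `n ≥ 1`, and `H^0(Σ_p; V)` is the subspace of
`Σ_p`-invariants of `V`. -/
theorem stmt_7 (p : ℕ) (hp : p.Prime)
    (V : Submodule (ZMod p) (MvPolynomial (Fin p) (ZMod p)))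
    (hV : V = Submodule.span (ZMod p) {m | ∃ a : Fin p →₀ ℕ, a ≠ 0 ∧ (∃ i, a i = 0) ∧
      m = MvPolynomial.monomial a 1})
    (ρ : Representation (ZMod p) (Equiv.Perm (Fin p)) V)
    (hρ : ∀ (g : Equiv.Perm (Fin p)) (x : V),
      ((ρ g x : V) : MvPolynomial (Fin p) (ZMod p))
        = MvPolynomial.rename (⇑g) (x : MvPolynomial (Fin p) (ZMod p))) :
    (∀ n : ℕ, 1 ≤ n → Limits.IsZero (groupCohomology (Rep.of ρ) n)) ∧
    Nonempty (groupCohomology (Rep.of ρ) 0 ≅ ModuleCat.of (ZMod p) ρ.invariants) := by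
  obtain ⟨e, he⟩ := exists_sum_conj_eq_self p hp V hV ρ hρ
  refine ⟨fun n hn ↦ ?_, ⟨groupCohomology.H0Iso (Rep.of ρ)⟩⟩
  obtain ⟨n, rfl⟩ := Nat.exists_eq_add_of_le' hn
  exact isZero_groupCohomology_succ_of_sum_eq (Rep.of ρ) e he n
end

section
/- Let $p$ be a prime and let $A = \mathbb{F}_p[x_1,\dots,x_p]/(e_p)$ be the quotient of the polynomial ring by the ideal generated by the $p$-th elementary symmetric polynomial $e_p = x_1x_2\cdots x_p$, with the symmetric group $\Sigma_p$ acting by permuting the variables. Then the subalgebra $A^{\Sigma_p}$ of $\Sigma_p$-invariants is generated by the images $\bar e_1,\dots,\bar e_{p-1}$ of the elementary symmetric polynomials $e_1,\dots,e_{p-1}$, and these images are algebraically independent over $\mathbb{F}_p$; that is, $A^{\Sigma_p}$ is a polynomial algebra $\mathbb{F}_p[\bar e_1,\dots,\bar e_{p-1}]$. -/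
open MvPolynomial

namespace MvPolynomial

variable {R : Type*} [CommRing R]

lemma esymm_card_eq_monomial (σ : Type*) [Fintype σ] :
    esymm σ R (Fintype.card σ) = monomial (Finsupp.equivFunOnFinite.symm 1) 1 := by
  classical
  rw [esymm, ← Finset.card_univ, Finset.powersetCard_self, Finset.sum_singleton, monomial_eq,
    Finsupp.prod_fintype _ _ (by simp)]
  simp

/-- A polynomial which is symmetric modulo `∏ i, X i` is congruent to a symmetric polynomial. -/
lemma exists_isSymmetric_sub_mem_span_esymm_card {σ : Type*} [Fintype σ] {f : MvPolynomial σ R}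
    (hf : ∀ g : Equiv.Perm σ,
      rename g f - f ∈ Ideal.span {esymm σ R (Fintype.card σ)}) :
    ∃ h : MvPolynomial σ R, h.IsSymmetric ∧
      f - h ∈ Ideal.span {esymm σ R (Fintype.card σ)} := by
  simp only [esymm_card_eq_monomial, Ideal.mem_span_singleton] at hf ⊢
  set s : σ →₀ ℕ := Finsupp.equivFunOnFinite.symm 1 with hs
  refine ⟨f.modMonomial s, fun g => ?_, ?_⟩
  · ext d
    obtain ⟨d, rfl⟩ : ∃ d', Finsupp.mapDomain g d' = d :=
      ⟨Finsupp.mapDomain g.symm d, by simp [← Finsupp.mapDomain_comp]⟩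
    rw [coeff_rename_mapDomain _ g.injective]
    have hd : s ≤ Finsupp.mapDomain g d ↔ s ≤ d := by
      simp only [Finsupp.le_def, hs, Finsupp.mapDomain_equiv_apply]
      simpa using g.symm.forall_congr_left (p := fun i => 1 ≤ d (g.symm i))
    by_cases h : s ≤ d
    · rw [coeff_modMonomial_of_le _ h, coeff_modMonomial_of_le _ (hd.2 h)]
    · have h' : ¬ s ≤ Finsupp.mapDomain g d := fun h' => h (hd.1 h')
      rw [coeff_modMonomial_of_not_le _ h, coeff_modMonomial_of_not_le _ h',
        ← coeff_rename_mapDomain _ g.injective]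
      obtain ⟨q, hq⟩ := hf g
      rw [← sub_eq_zero, ← coeff_sub, hq, coeff_monomial_mul', if_neg h']
  · exact ⟨f.divMonomial s, sub_eq_of_eq_add (divMonomial_add_modMonomial f s).symm⟩

lemma adjoin_range_esymm_eq_symmetricSubalgebra (n : ℕ) :
    Algebra.adjoin R (Set.range fun i : Fin n => esymm (Fin n) R (i + 1)) =
      symmetricSubalgebra (Fin n) R := by
  refine le_antisymm (Algebra.adjoin_le ?_) fun f hf => ?_
  · rintro _ ⟨i, rfl⟩
    exact esymm_isSymmetric _ _ _
  · obtain ⟨q, hq⟩ := esymmAlgHom_surjective (σ := Fin n) R (n := n) (by simp) ⟨f, hf⟩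
    rw [Algebra.adjoin_range_eq_range_aeval]
    exact ⟨q, (esymmAlgHom_apply q).symm.trans (congrArg Subtype.val hq)⟩

lemma mk_mem_adjoin_mk_esymm {n : ℕ} {f : MvPolynomial (Fin (n + 1)) R} (hf : f.IsSymmetric) :
    Ideal.Quotient.mk (Ideal.span {esymm (Fin (n + 1)) R (n + 1)}) f ∈
      Algebra.adjoin R (Set.range fun i : Fin n =>
        Ideal.Quotient.mk (Ideal.span {esymm (Fin (n + 1)) R (n + 1)})
          (esymm (Fin (n + 1)) R (i + 1))) := by
  have hf' : f ∈ symmetricSubalgebra (Fin (n + 1)) R := hf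
  rw [← adjoin_range_esymm_eq_symmetricSubalgebra] at hf'
  induction hf' using Algebra.adjoin_induction with
  | mem x hx =>
    obtain ⟨i, rfl⟩ := hx
    induction i using Fin.lastCases with
    | last =>
      convert Subalgebra.zero_mem _
      exact Ideal.Quotient.eq_zero_iff_mem.2 (Ideal.mem_span_singleton_self _)
    | cast i => exact Algebra.subset_adjoin ⟨i, rfl⟩
  | algebraMap r => exact Subalgebra.algebraMap_mem _ r
  | add x y hx hy ihx ihy =>
    rw [adjoin_range_esymm_eq_symmetricSubalgebra] at hx hy
    rw [map_add]
    exact add_mem (ihx hx) (ihy hy)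
  | mul x y hx hy ihx ihy =>
    rw [adjoin_range_esymm_eq_symmetricSubalgebra] at hx hy
    rw [map_mul]
    exact mul_mem (ihx hx) (ihy hy)

lemma IsSymmetric.of_mul_left [IsDomain R] {σ : Type*} {f g : MvPolynomial σ R}
    (hf : f.IsSymmetric) (hf0 : f ≠ 0) (hfg : (f * g).IsSymmetric) : g.IsSymmetric := fun e => by
  have h := hfg e
  rw [map_mul, hf e] at h
  exact mul_left_cancel₀ hf0 h

lemma algebraicIndependent_mk_esymm [IsDomain R] (n : ℕ) :
    AlgebraicIndependent R fun i : Fin n =>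
      Ideal.Quotient.mk (Ideal.span {esymm (Fin (n + 1)) R (n + 1)})
        (esymm (Fin (n + 1)) R (i + 1)) := by
  rw [algebraicIndependent_iff]
  intro q hq
  have hmk : Ideal.Quotient.mk (Ideal.span {esymm (Fin (n + 1)) R (n + 1)})
      (esymmAlgHom (Fin (n + 1)) R (n + 1) (rename Fin.castSucc q)) = 0 := by
    rw [esymmAlgHom_apply, aeval_rename, ← hq]
    exact (comp_aeval_apply (fun i : Fin n => esymm (Fin (n + 1)) R (i + 1))
      (Ideal.Quotient.mkₐ R (Ideal.span {esymm (Fin (n + 1)) R (n + 1)})) q)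
  rw [Ideal.Quotient.eq_zero_iff_mem, Ideal.mem_span_singleton] at hmk
  obtain ⟨h, hh⟩ := hmk
  have h0 : esymm (Fin (n + 1)) R (n + 1) ≠ 0 := by
    have := esymm_card_eq_monomial (R := R) (Fin (n + 1))
    rw [Fintype.card_fin] at this
    simp [this]
  have hsymm : h.IsSymmetric :=
    (esymm_isSymmetric _ _ _).of_mul_left h0 (hh ▸ (esymmAlgHom _ _ _ _).2)
  obtain ⟨r, hr⟩ := esymmAlgHom_surjective (σ := Fin (n + 1)) R (n := n + 1) (by simp) ⟨h, hsymm⟩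
  have hqr : rename Fin.castSucc q = X (Fin.last n) * r := by
    apply esymmAlgHom_injective (σ := Fin (n + 1)) R (n := n + 1) (by simp)
    apply Subtype.ext
    rw [hh, map_mul, hr]
    simp [esymmAlgHom]
  have := congrArg (aeval (Fin.lastCases 0 X : Fin (n + 1) → MvPolynomial (Fin n) R)) hqr
  rw [aeval_rename, map_mul, aeval_X, Fin.lastCases_last, zero_mul] at this
  simpa only [Function.comp_def, Fin.lastCases_castSucc, aeval_X_left_apply] using this

end MvPolynomial

/-- Let `p` be a prime and `A = 𝔽_p[x₁,…,x_p]/(e_p)` the quotient by the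
ideal generated by `e_p = x₁⋯x_p`, with `Σ_p` acting by permuting the variables (the
descended action `act`, compatible with `rename` on the polynomial ring).  Then the
subalgebra of `Σ_p`-invariants of `A` is generated by the images of `e₁,…,e_{p-1}`, and
these images are algebraically independent over `𝔽_p`; i.e. the invariants form a
polynomial algebra `𝔽_p[ē₁,…,ē_{p-1}]`. -/
theorem stmt_8 (p : ℕ) (hp : p.Prime)
    (act : Equiv.Perm (Fin p) →
      (MvPolynomial (Fin p) (ZMod p) ⧸
          Ideal.span {esymm (Fin p) (ZMod p) p}) →ₐ[ZMod p]
      (MvPolynomial (Fin p) (ZMod p) ⧸ Ideal.span {esymm (Fin p) (ZMod p) p}))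
    (hact : ∀ (g : Equiv.Perm (Fin p)) (f : MvPolynomial (Fin p) (ZMod p)),
      act g (Ideal.Quotient.mk (Ideal.span {esymm (Fin p) (ZMod p) p}) f)
        = Ideal.Quotient.mk (Ideal.span {esymm (Fin p) (ZMod p) p})
            (MvPolynomial.rename (⇑g) f)) :
    ((Algebra.adjoin (ZMod p) (Set.range fun i : Fin (p - 1) =>
        Ideal.Quotient.mk (Ideal.span {esymm (Fin p) (ZMod p) p})
          (esymm (Fin p) (ZMod p) ((i : ℕ) + 1))) :
        Set (MvPolynomial (Fin p) (ZMod p) ⧸ Ideal.span {esymm (Fin p) (ZMod p) p}))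
      = {a | ∀ g : Equiv.Perm (Fin p), act g a = a}) ∧
    AlgebraicIndependent (ZMod p) (fun i : Fin (p - 1) =>
      Ideal.Quotient.mk (Ideal.span {esymm (Fin p) (ZMod p) p})
        (esymm (Fin p) (ZMod p) ((i : ℕ) + 1))) := by
  obtain ⟨n, rfl⟩ := Nat.exists_eq_add_one_of_ne_zero hp.ne_zero
  have : Fact (n + 1).Prime := ⟨hp⟩
  refine ⟨Set.Subset.antisymm (fun a ha g => ?_) fun a ha => ?_, algebraicIndependent_mk_esymm n⟩
  · refine Algebra.adjoin_le (S := AlgHom.equalizer (act g) (AlgHom.id _ _)) ?_ ha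
    rintro _ ⟨i, rfl⟩
    exact (hact g _).trans (congrArg _ (esymm_isSymmetric _ _ _ g))
  · obtain ⟨f, rfl⟩ := Ideal.Quotient.mk_surjective a
    obtain ⟨h, hsymm, hfh⟩ := exists_isSymmetric_sub_mem_span_esymm_card (f := f) fun g => by
      rw [Fintype.card_fin, ← Ideal.Quotient.mk_eq_mk_iff_sub_mem, ← hact]
      exact ha g
    rw [Fintype.card_fin, ← Ideal.Quotient.mk_eq_mk_iff_sub_mem] at hfh
    rw [hfh]
    exact mk_mem_adjoin_mk_esymm hsymm
end
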